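/- Let (Z, ρ) be a compact metric space with at least two points, and for each z ∈ Z let P_z be a probability measure such that for all z, z' ∈ Z and every measurable T, P_z(T) ≤ e^ε·P_{z'}(T) (the ε-DP condition). Then for any estimator ẑ from n i.i.d. samples, inf_{ẑ} sup_{z∈Z} E_{P_zⁿ}[ρ(z, ẑ)²] ≥ (diam(Z)²/16)·exp(−n·ε·tanh(ε/2)), where diam(Z) = sup_{z,z'} ρ(z, z'). -/

import Mathlib

open MeasureTheory Real

/-- The inequality `log cosh x ≤ x tanh x`, in exponential form. -/
theorem exp_neg_mul_tanh_le_inv_cosh (x : ℝ) : exp (-(x * tanh x)) ≤ (cosh x)⁻¹ := by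
  have hc := cosh_pos x
  have hweight : exp x / (2 * cosh x) + exp (-x) / (2 * cosh x) = 1 := by
    rw [← add_div, div_eq_one_iff_eq (by positivity), cosh_eq]
    ring
  have hjensen := convexOn_exp.2 (Set.mem_univ (-x)) (Set.mem_univ x)
    (by positivity) (by positivity) hweight
  simp only [smul_eq_mul] at hjensen
  have hmean : exp x / (2 * cosh x) * -x + exp (-x) / (2 * cosh x) * x = -(x * tanh x) := by
    rw [tanh_eq_sinh_div_cosh, sinh_eq]
    field_simp
    ring
  have hval : exp x / (2 * cosh x) * exp (-x) + exp (-x) / (2 * cosh x) * exp x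
      = (cosh x)⁻¹ := by
    have hexp : exp x * exp (-x) = 1 := by rw [← exp_add]; simp
    field_simp
    linarith
  rwa [hmean, hval] at hjensen

/-- Mutually dominated measures have a density whose square root is bounded above and below. -/
theorem exists_sq_density_of_mutual_le {Ω : Type*} [MeasurableSpace Ω] {μ ν : Measure Ω}
    [IsProbabilityMeasure μ] [IsProbabilityMeasure ν] {ε : ℝ} (hε : 0 ≤ ε)
    (hμν : ∀ T, MeasurableSet T → μ T ≤ ENNReal.ofReal (exp ε) * ν T)
    (hνμ : ∀ T, MeasurableSet T → ν T ≤ ENNReal.ofReal (exp ε) * μ T) :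
    ∃ s : Ω → ℝ, Measurable s ∧ (∀ ω, exp (-(ε / 2)) ≤ s ω) ∧ (∀ ω, s ω ≤ exp (ε / 2)) ∧
      μ = ν.withDensity fun ω => ENNReal.ofReal (s ω ^ 2) := by
  have hac : μ ≪ ν := Measure.AbsolutelyContinuous.mk fun T hT h => by
    simpa [h] using hμν T hT
  have hr := μ.measurable_rnDeriv ν
  have hupper : μ.rnDeriv ν ≤ᵐ[ν] fun _ => ENNReal.ofReal (exp ε) := by
    refine ae_le_of_forall_setLIntegral_le_of_sigmaFinite hr fun T hT _ => ?_
    rw [Measure.setLIntegral_rnDeriv hac, setLIntegral_const]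
    exact hμν T hT
  have hlower : (fun _ => 1) ≤ᵐ[ν] fun ω => ENNReal.ofReal (exp ε) * μ.rnDeriv ν ω := by
    refine ae_le_of_forall_setLIntegral_le_of_sigmaFinite measurable_const fun T hT _ => ?_
    rw [lintegral_const_mul _ hr, Measure.setLIntegral_rnDeriv hac, setLIntegral_const, one_mul]
    exact hνμ T hT
  refine ⟨fun ω => max (exp (-(ε / 2))) (min (exp (ε / 2)) (√(μ.rnDeriv ν ω).toReal)),
    by fun_prop, fun ω => le_max_left _ _,
    fun ω => max_le (exp_le_exp.2 (by linarith)) (min_le_left _ _), ?_⟩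
  conv_lhs => rw [← Measure.withDensity_rnDeriv_eq μ ν hac]
  refine withDensity_congr_ae ?_
  filter_upwards [hupper, hlower] with ω hu hl
  have hfin : μ.rnDeriv ν ω ≠ ⊤ := ne_top_of_le_ne_top ENNReal.ofReal_ne_top hu
  have hu' : (μ.rnDeriv ν ω).toReal ≤ exp ε := ENNReal.toReal_le_of_le_ofReal (exp_pos _).le hu
  have hl' : 1 ≤ exp ε * (μ.rnDeriv ν ω).toReal := by
    have := ENNReal.toReal_mono (ENNReal.mul_ne_top ENNReal.ofReal_ne_top hfin) hl
    simpa [ENNReal.toReal_mul, (exp_pos ε).le] using this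
  have hsu : √(μ.rnDeriv ν ω).toReal ≤ exp (ε / 2) := by
    rw [exp_half]
    exact sqrt_le_sqrt hu'
  have hsl : exp (-(ε / 2)) ≤ √(μ.rnDeriv ν ω).toReal := by
    rw [← neg_div, exp_half]
    refine sqrt_le_sqrt ?_
    rw [exp_neg]
    exact (inv_le_iff_one_le_mul₀' (exp_pos ε)).2 hl'
  rw [min_eq_right hsu, max_eq_right hsl, sq_sqrt ENNReal.toReal_nonneg, ENNReal.ofReal_toReal hfin]

/-- A finite power of a measure with bounded density has the product density. -/
theorem pi_withDensity_ofReal {Ω ι : Type*} [Fintype ι] [MeasurableSpace Ω] (ν : Measure Ω)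
    [IsFiniteMeasure ν] {f : Ω → ℝ} (hf : Integrable f ν) (hf0 : ∀ ω, 0 ≤ f ω) :
    (Measure.pi fun _ : ι => ν.withDensity fun ω => ENNReal.ofReal (f ω)) =
      (Measure.pi fun _ : ι => ν).withDensity fun x => ENNReal.ofReal (∏ i, f (x i)) := by
  have := isFiniteMeasure_withDensity_ofReal hf.2
  refine Measure.pi_eq fun t ht => ?_
  rw [withDensity_apply _ (MeasurableSet.univ_pi ht), Measure.restrict_pi_pi,
    ← ofReal_integral_eq_lintegral_ofReal
      (Integrable.fintype_prod (f := fun _ => f) fun i => hf.restrict)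
      (.of_forall fun x => Finset.prod_nonneg fun i _ => hf0 _),
    integral_fintype_prod_eq_prod (fun _ : ι => f),
    ENNReal.ofReal_prod_of_nonneg fun i _ => integral_nonneg hf0]
  refine Finset.prod_congr rfl fun i _ => ?_
  rw [withDensity_apply _ (ht i),
    ofReal_integral_eq_lintegral_ofReal hf.restrict (.of_forall hf0)]

/-- A density whose square root `s` lies in `[exp (-x), exp x]` has Bhattacharyya coefficient at
least `1 / cosh x`. -/
theorem inv_cosh_le_integral_of_mem_Icc {Ω : Type*} [MeasurableSpace Ω] {ν : Measure Ω}
    [IsProbabilityMeasure ν] {x : ℝ} {s : Ω → ℝ} (hs : Integrable s ν)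
    (hs2 : Integrable (fun ω => s ω ^ 2) ν) (hl : ∀ ω, exp (-x) ≤ s ω) (hu : ∀ ω, s ω ≤ exp x)
    (hone : ∫ ω, s ω ^ 2 ∂ν = 1) : (cosh x)⁻¹ ≤ ∫ ω, s ω ∂ν := by
  have hmono : ∫ ω, (s ω ^ 2 + 1) ∂ν ≤ ∫ ω, 2 * cosh x * s ω ∂ν := by
    refine integral_mono (hs2.add (integrable_const 1)) (hs.const_mul _) fun ω => ?_
    have hexp : exp x * exp (-x) = 1 := by rw [← exp_add]; simp
    have := mul_nonneg (sub_nonneg.2 (hl ω)) (sub_nonneg.2 (hu ω))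
    simp only [cosh_eq]
    nlinarith
  rw [integral_add hs2 (integrable_const 1), hone, integral_const_mul] at hmono
  simp only [integral_const, probReal_univ, smul_eq_mul] at hmono
  rw [inv_le_iff_one_le_mul₀ (cosh_pos x)]
  linarith

/-- A two-point bound: if `a + b ≥ d` pointwise, the sum of the second moments of `a` and `b` under
the measures with densities `S ^ 2` and `1` is at least `d ^ 2 / 2` times the squared
Bhattacharyya coefficient. -/
theorem sq_mul_integral_sq_le_integral_add {X : Type*} [MeasurableSpace X] {ν : Measure X}
    [IsProbabilityMeasure ν] {S a b : X → ℝ} {d : ℝ} (hd : 0 ≤ d) (hS : Integrable S ν)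
    (hS2 : Integrable (fun x => S x ^ 2) ν) (hone : ∫ x, S x ^ 2 ∂ν = 1)
    (ha : Integrable (fun x => S x ^ 2 * a x ^ 2) ν) (hb : Integrable (fun x => b x ^ 2) ν)
    (hab : ∀ x, d ≤ a x + b x) :
    d ^ 2 * (∫ x, S x ∂ν) ^ 2 / 2 ≤
      ∫ x, S x ^ 2 * a x ^ 2 ∂ν + ∫ x, b x ^ 2 ∂ν := by
  set B := ∫ x, S x ∂ν with hB
  have hS2one : Integrable (fun x => S x ^ 2 + 1) ν := hS2.add (integrable_const 1)
  have hmono : ∫ x, d ^ 2 * (B * S x - B ^ 2 / 4 * (S x ^ 2 + 1)) ∂ν ≤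
      ∫ x, (S x ^ 2 * a x ^ 2 + b x ^ 2) ∂ν := by
    refine integral_mono (((hS.const_mul _).sub (hS2one.const_mul _)).const_mul _) (ha.add hb) fun x => ?_
    have hpos : 0 < S x ^ 2 + 1 := by positivity
    have hd2 : d ^ 2 ≤ (a x + b x) ^ 2 := pow_le_pow_left₀ hd (hab x) 2
    have hharm : d ^ 2 * S x ^ 2 ≤ (S x ^ 2 * a x ^ 2 + b x ^ 2) * (S x ^ 2 + 1) := by
      nlinarith [mul_le_mul_of_nonneg_right hd2 (sq_nonneg (S x)),
        sq_nonneg (S x ^ 2 * a x - b x)]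
    have hamgm : (B * S x - B ^ 2 / 4 * (S x ^ 2 + 1)) * (S x ^ 2 + 1) ≤ S x ^ 2 := by
      nlinarith [sq_nonneg (S x - B / 2 * (S x ^ 2 + 1))]
    refine le_of_mul_le_mul_right ?_ hpos
    calc _ = d ^ 2 * ((B * S x - B ^ 2 / 4 * (S x ^ 2 + 1)) * (S x ^ 2 + 1)) := by ring
      _ ≤ d ^ 2 * S x ^ 2 := by gcongr
      _ ≤ _ := hharm
  rw [integral_add ha hb, integral_const_mul,
    integral_sub (hS.const_mul _) (hS2one.const_mul _),
    integral_const_mul, integral_const_mul, integral_add hS2 (integrable_const 1), hone, ← hB]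
    at hmono
  simp only [integral_const, probReal_univ, smul_eq_mul] at hmono
  linarith

/-- In a nonempty compact metric space the diameter is attained. -/
theorem exists_dist_eq_diam_univ (Z : Type*) [MetricSpace Z] [CompactSpace Z] [Nonempty Z] :
    ∃ z z' : Z, dist z z' = Metric.diam (Set.univ : Set Z) := by
  obtain ⟨⟨z, z'⟩, -, hmax⟩ := (isCompact_univ (X := Z × Z)).exists_isMaxOn Set.univ_nonempty
    (continuous_dist.continuousOn (s := Set.univ))
  refine ⟨z, z', le_antisymm ?_ (Metric.diam_le_of_forall_dist_le dist_nonneg fun x _ y _ => ?_)⟩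
  · exact Metric.dist_le_diam_of_mem isCompact_univ.isBounded (Set.mem_univ _) (Set.mem_univ _)
  · exact hmax (Set.mem_univ (x, y))

/-- Minimax reconstruction lower bound against ε-DP learners (Theorem 1, δ = 0):
for mechanisms `P z` satisfying the ε-DP condition on a compact metric data space `Z`,
any estimator from `n` i.i.d. samples incurs worst-case squared-distance risk at least
`(diam(Z)²/16)·exp(−n·ε·tanh(ε/2))`. -/
theorem dp_minimax_lower_bound {Ω Z : Type*} [MeasurableSpace Ω]
    [MetricSpace Z] [CompactSpace Z] [Nontrivial Z] [MeasurableSpace Z] [BorelSpace Z]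
    (ε : ℝ) (hε : 0 ≤ ε) (n : ℕ) (hn : 1 ≤ n)
    (P : Z → Measure Ω) (hP : ∀ z, IsProbabilityMeasure (P z))
    (hDP : ∀ z z' : Z, ∀ T : Set Ω, MeasurableSet T →
      P z T ≤ ENNReal.ofReal (exp ε) * P z' T) :
    (Metric.diam (Set.univ : Set Z)) ^ 2 / 16 * exp (-(n * ε * tanh (ε / 2))) ≤
      ⨅ zhat : {f : (Fin n → Ω) → Z // Measurable f}, ⨆ z : Z,
        ∫ ω, (dist z (zhat.1 ω)) ^ 2 ∂(Measure.pi fun _ : Fin n => P z) := by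
  obtain ⟨z₀, z₁, hdiam⟩ := exists_dist_eq_diam_univ Z
  have : Nonempty {f : (Fin n → Ω) → Z // Measurable f} := ⟨⟨fun _ => z₀, measurable_const⟩⟩
  refine le_ciInf fun ⟨f, hf⟩ => ?_
  set D := Metric.diam (Set.univ : Set Z)
  have hD : 0 ≤ D := Metric.diam_nonneg
  have hdist : ∀ z z' : Z, dist z z' ≤ D := fun z z' =>
    Metric.dist_le_diam_of_mem isCompact_univ.isBounded (Set.mem_univ _) (Set.mem_univ _)
  have hmeas : ∀ z, Measurable fun ω => dist z (f ω) ^ 2 := fun z =>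
    (measurable_const.dist hf).pow_const 2
  have hint : ∀ z z', Integrable (fun ω => dist z (f ω) ^ 2)
      (Measure.pi fun _ : Fin n => P z') := fun z z' =>
    .of_bound (hmeas z).aestronglyMeasurable (D ^ 2) (.of_forall fun ω => by
      rw [norm_of_nonneg (by positivity)]
      exact pow_le_pow_left₀ dist_nonneg (hdist _ _) 2)
  have hbdd : BddAbove (Set.range fun z : Z =>
      ∫ ω, dist z (f ω) ^ 2 ∂(Measure.pi fun _ : Fin n => P z)) := by
    refine ⟨D ^ 2, ?_⟩
    rintro _ ⟨z, rfl⟩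
    refine (integral_mono (hint z z) (integrable_const (D ^ 2)) fun ω =>
      pow_le_pow_left₀ dist_nonneg (hdist _ _) 2).trans ?_
    simp
  have h₀ := le_ciSup hbdd z₀
  have h₁ := le_ciSup hbdd z₁
  obtain ⟨s, hs, hsl, hsu, hdens⟩ := exists_sq_density_of_mutual_le hε (hDP z₀ z₁) (hDP z₁ z₀)
  have hs0 : ∀ ω, 0 ≤ s ω := fun ω => (exp_pos _).le.trans (hsl ω)
  have hsint : Integrable s (P z₁) :=
    .of_bound hs.aestronglyMeasurable (exp (ε / 2)) (.of_forall fun ω => by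
      rw [norm_of_nonneg (hs0 ω)]
      exact hsu ω)
  have hs2int : Integrable (fun ω => s ω ^ 2) (P z₁) :=
    .of_bound (hs.pow_const 2).aestronglyMeasurable (exp (ε / 2) ^ 2) (.of_forall fun ω => by
      rw [norm_of_nonneg (by positivity)]
      exact pow_le_pow_left₀ (hs0 ω) (hsu ω) 2)
  have hone : ∫ ω, s ω ^ 2 ∂(P z₁) = 1 := by
    have hmass : P z₀ Set.univ = 1 := measure_univ
    rw [hdens, withDensity_apply _ MeasurableSet.univ, Measure.restrict_univ,
      ← ofReal_integral_eq_lintegral_ofReal hs2int (.of_forall fun ω => sq_nonneg _)] at hmass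
    simpa using hmass
  have hpi := pi_withDensity_ofReal (ι := Fin n) (P z₁) hs2int fun ω => sq_nonneg _
  rw [← hdens] at hpi
  set ν := Measure.pi fun _ : Fin n => P z₁
  set S : (Fin n → Ω) → ℝ := fun x => ∏ i, s (x i)
  have hS : Measurable S := Finset.measurable_fun_prod _ fun i _ => hs.comp (measurable_pi_apply i)
  have hSsq : ∀ x, S x ^ 2 = ∏ i, s (x i) ^ 2 := fun x => (Finset.prod_pow _ _ _).symm
  have hSint : Integrable S ν := Integrable.fintype_prod (f := fun _ => s) fun _ => hsint
  have hS2int : Integrable (fun x => S x ^ 2) ν := by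
    simp_rw [hSsq]
    exact Integrable.fintype_prod (f := fun _ ω => s ω ^ 2) fun _ => hs2int
  have hSone : ∫ x, S x ^ 2 ∂ν = 1 := by
    simp_rw [hSsq]
    rw [integral_fintype_prod_eq_pow (fun ω => s ω ^ 2), hone, one_pow]
  have hchange : ∫ ω, dist z₀ (f ω) ^ 2 ∂(Measure.pi fun _ : Fin n => P z₀) =
      ∫ x, S x ^ 2 * dist z₀ (f x) ^ 2 ∂ν := by
    simp_rw [hpi, ← hSsq]
    rw [integral_withDensity_eq_integral_toReal_smul
      (hS.pow_const 2).ennreal_ofReal (.of_forall fun _ => ENNReal.ofReal_lt_top)]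
    simp [ENNReal.toReal_ofReal, sq_nonneg]
  have htwo := sq_mul_integral_sq_le_integral_add hD hSint hS2int hSone
    (hS2int.mul_bdd (c := D ^ 2) (hmeas z₀).aestronglyMeasurable (.of_forall fun ω => by
      rw [norm_of_nonneg (by positivity)]
      exact pow_le_pow_left₀ dist_nonneg (hdist _ _) 2)) (hint z₁ z₁)
    fun x => hdiam.symm.le.trans (dist_triangle_right z₀ z₁ (f x))
  have hcoef : exp (-(n * ε * tanh (ε / 2))) ≤ (∫ x, S x ∂ν) ^ 2 := by
    have hbase := (exp_neg_mul_tanh_le_inv_cosh (ε / 2)).trans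
      (inv_cosh_le_integral_of_mem_Icc hsint hs2int hsl hsu hone)
    rw [integral_fintype_prod_eq_pow s, Fintype.card_fin, ← pow_mul]
    calc exp (-(n * ε * tanh (ε / 2)))
        = exp (-(ε / 2 * tanh (ε / 2))) ^ (n * 2) := by
          rw [← exp_nat_mul]
          push_cast
          ring_nf
      _ ≤ _ := pow_le_pow_left₀ (exp_pos _).le hbase _
  rw [← hchange] at htwo
  have hscaled := mul_le_mul_of_nonneg_left hcoef (sq_nonneg D)
  have hnonneg := mul_nonneg (sq_nonneg D) (exp_pos (-(n * ε * tanh (ε / 2)))).le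
  simp only at h₀ h₁ ⊢
  linarith
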